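/- Let (T,d) be a compact metric space and m a Borel probability measure on T. Let φ and ψ be Young functions with φ(1)=ψ(1)=1, and suppose there exist R>1 and an integer n₀≥1 such that (i) φ(R^k)/φ(R^{k+1}) ≤ φ(R^{k-1})/φ(R^k) for all integers k≥1, and (ii) Σ_{k=0}^{∞} φ(R^k)/ψ(R^{k+n₀}) < ∞. Then there exists a constant K ∈ (0,∞) depending only on φ, ψ, R, n₀ such that for every probability space (Ω,F,P) and every stochastic process X : Ω × T → ℝ with continuous sample paths and ψ-bounded increments: E[ sup_{s,t∈T, s≠t} |X(·,s)−X(·,t)| / (2K τ_{m,φ}(s,t)) ] ≤ 1. -/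

import Mathlib

open MeasureTheory ENNReal Filter

noncomputable section

/-- A (finite) Young function: an increasing convex function `φ : [0,∞) → [0,∞)`
with `φ 0 = 0` and `φ x → ∞` as `x → ∞`. -/
def IsYoungFunction (φ : ℝ → ℝ) : Prop :=
  MonotoneOn φ (Set.Ici 0) ∧ ConvexOn ℝ (Set.Ici 0) φ ∧ φ 0 = 0 ∧
    Tendsto φ atTop atTop

/-- Generalized inverse of a Young function, as a map `ℝ≥0∞ → ℝ≥0∞`
(so that in particular `φ⁻¹(∞) = ∞`). -/
def yinv (φ : ℝ → ℝ) (y : ℝ≥0∞) : ℝ≥0∞ :=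
  sInf {x : ℝ≥0∞ | ∃ r : ℝ, 0 ≤ r ∧ x = ENNReal.ofReal r ∧ y ≤ ENNReal.ofReal (φ r)}

/-- The minorizing metric
`τ_{m,φ}(s,t) = max_{x ∈ {s,t}} ∫_0^{d(s,t)} φ⁻¹(1 / m(B(x,ε))) dε`,
with the conventions `1/0 = ∞`, `φ⁻¹(∞) = ∞`. -/
def tauDist {T : Type*} [MetricSpace T] [MeasurableSpace T]
    (m : Measure T) (φ : ℝ → ℝ) (s t : T) : ℝ≥0∞ :=
  max (∫⁻ ε in Set.Ioc (0 : ℝ) (dist s t), yinv φ (1 / m (Metric.closedBall s ε)))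
    (∫⁻ ε in Set.Ioc (0 : ℝ) (dist s t), yinv φ (1 / m (Metric.closedBall t ε)))

/-- `f^d(u,v) = |f(u) - f(v)| / d(u,v)`, equal to `0` on the diagonal. -/
def fdiv {T : Type*} [MetricSpace T] (f : T → ℝ) (p : T × T) : ℝ :=
  |f p.1 - f p.2| / dist p.1 p.2

/-- The Luxemburg norm `|g|^ν_χ = inf {a > 0 : ∫ χ(|g|/a) dν ≤ 1}`, with value `∞`
if no such `a` exists. -/
def luxNorm {X : Type*} [MeasurableSpace X] (ν : Measure X) (χ : ℝ → ℝ)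
    (g : X → ℝ) : ℝ≥0∞ :=
  sInf {a : ℝ≥0∞ | ∃ b : ℝ, 0 < b ∧ a = ENNReal.ofReal b ∧
    ∫⁻ u, ENNReal.ofReal (χ (|g u| / b)) ∂ν ≤ 1}

/-- The Amemiya norm `‖g‖^μ_χ = inf_{a>0} a (1 + ∫ χ(|g|/a) dμ)`. -/
def amemiyaNorm {X : Type*} [MeasurableSpace X] (μ : Measure X) (χ : ℝ → ℝ)
    (g : X → ℝ) : ℝ≥0∞ :=
  sInf {c : ℝ≥0∞ | ∃ a : ℝ, 0 < a ∧
    c = ENNReal.ofReal a * (1 + ∫⁻ u, ENNReal.ofReal (χ (|g u| / a)) ∂μ)}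

/-- `r_0(x) = D(T)` and, for `k ≥ 1`,
`r_k(x) = min {ε ≥ 0 : 1 / m(B(x,ε)) ≤ φ(R^k)}` (with `1/0 = ∞`). -/
def rad {T : Type*} [MetricSpace T] [MeasurableSpace T]
    (m : Measure T) (φ : ℝ → ℝ) (R : ℝ) : ℕ → T → ℝ
  | 0, _ => Metric.diam (Set.univ : Set T)
  | k + 1, x => sInf {ε : ℝ | 0 ≤ ε ∧
      1 / m (Metric.closedBall x ε) ≤ ENNReal.ofReal (φ (R ^ (k + 1)))}

/-- `r^l_k(x) = ∑_{i=k}^{l} 2^(i-k) r_i(x)`. -/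
def radl {T : Type*} [MetricSpace T] [MeasurableSpace T]
    (m : Measure T) (φ : ℝ → ℝ) (R : ℝ) (k l : ℕ) (x : T) : ℝ :=
  ∑ i ∈ Finset.Icc k l, (2 : ℝ) ^ (i - k) * rad m φ R i x

/-- The averaging operator `S_k f (x) = (1 / m(B_k(x))) ∫_{B_k(x)} f dm`,
with the convention `0/0 = 0`. -/
def avg {T : Type*} [MetricSpace T] [MeasurableSpace T]
    (m : Measure T) (φ : ℝ → ℝ) (R : ℝ) (k : ℕ) (f : T → ℝ) (x : T) : ℝ :=
  (∫ u in Metric.closedBall x (rad m φ R k x), f u ∂m) /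
    (m (Metric.closedBall x (rad m φ R k x))).toReal

/-- The iterated averaging operator `iterAvg k l f = S_l S_{l-1} ⋯ S_k f` (for `k ≤ l`). -/
def iterAvg {T : Type*} [MetricSpace T] [MeasurableSpace T]
    (m : Measure T) (φ : ℝ → ℝ) (R : ℝ) (k : ℕ) : ℕ → (T → ℝ) → T → ℝ
  | 0, f => avg m φ R 0 f
  | l + 1, f =>
      if l + 1 ≤ k then avg m φ R (l + 1) f
      else avg m φ R (l + 1) (iterAvg m φ R k l f)

/-- The set `{k ≥ 1 : B^l_k(s) ∪ B^l_k(t) ⊆ B°(u, r_{k-1}(u)) for every u ∈ B^l_k(x)}`,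
whose greatest element is `τ_x`. -/
def tauSet {T : Type*} [MetricSpace T] [MeasurableSpace T]
    (m : Measure T) (φ : ℝ → ℝ) (R : ℝ) (l : ℕ) (s t x : T) : Set ℕ :=
  {k : ℕ | 1 ≤ k ∧ ∀ u ∈ Metric.closedBall x (radl m φ R k l x),
    Metric.closedBall s (radl m φ R k l s) ∪ Metric.closedBall t (radl m φ R k l t) ⊆
      Metric.ball u (rad m φ R (k - 1) u)}

/-! ### Level radii -/

/-- The smallest radius `ε ≥ 0` for which the closed ball `B(x, ε)` has mass at least `1 / c`. -/
def levelRadius {T : Type*} [MetricSpace T] [MeasurableSpace T] (m : Measure T) (c : ℝ) (x : T) :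
    ℝ :=
  sInf {ε : ℝ | 0 ≤ ε ∧ 1 ≤ ENNReal.ofReal c * m (Metric.closedBall x ε)}

section LevelRadius

variable {T : Type*} [MetricSpace T] [MeasurableSpace T] (m : Measure T) {c : ℝ}

lemma levelRadius_nonneg (c : ℝ) (x : T) : 0 ≤ levelRadius m c x :=
  Real.sInf_nonneg fun _ h => h.1

lemma levelRadius_le {x : T} {ε : ℝ} (hε : 0 ≤ ε)
    (h : 1 ≤ ENNReal.ofReal c * m (Metric.closedBall x ε)) : levelRadius m c x ≤ ε :=
  csInf_le ⟨0, fun _ h => h.1⟩ ⟨hε, h⟩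

lemma mul_measure_closedBall_lt_one {x : T} {ε : ℝ} (hε : 0 ≤ ε) (h : ε < levelRadius m c x) :
    ENNReal.ofReal c * m (Metric.closedBall x ε) < 1 := by
  by_contra! h'
  exact absurd (levelRadius_le m hε h') (not_le.2 h)

lemma mul_measure_ball_levelRadius_le (x : T) :
    ENNReal.ofReal c * m (Metric.ball x (levelRadius m c x)) ≤ 1 := by
  rcases (levelRadius_nonneg m c x).eq_or_lt with h0 | h0
  · simp [← h0]
  have hun : Metric.ball x (levelRadius m c x) =
      ⋃ n : ℕ, Metric.closedBall x (levelRadius m c x - levelRadius m c x * (1 / ((n : ℝ) + 1))) := by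
    ext y
    simp only [Set.mem_iUnion, Metric.mem_closedBall, Metric.mem_ball]
    constructor
    · intro h
      have ht : Tendsto (fun n : ℕ => levelRadius m c x - levelRadius m c x * (1 / ((n : ℝ) + 1)))
          atTop (nhds (levelRadius m c x)) := by
        simpa using tendsto_const_nhds.sub
          ((tendsto_one_div_add_atTop_nhds_zero_nat (𝕜 := ℝ)).const_mul (levelRadius m c x))
      obtain ⟨n, hn⟩ := (ht.eventually (lt_mem_nhds h)).exists
      exact ⟨n, hn.le⟩
    · rintro ⟨n, hn⟩
      have : 0 < levelRadius m c x * (1 / ((n : ℝ) + 1)) := by positivity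
      linarith
  have hlim := tendsto_measure_iUnion_atTop (μ := m)
    (s := fun n : ℕ =>
      Metric.closedBall x (levelRadius m c x - levelRadius m c x * (1 / ((n : ℝ) + 1))))
    (fun i j hij => Metric.closedBall_subset_closedBall (by
      have : 1 / ((j : ℝ) + 1) ≤ 1 / ((i : ℝ) + 1) := one_div_le_one_div_of_le (by positivity)
        (by have : (i : ℝ) ≤ j := by exact_mod_cast hij
            linarith)
      gcongr))
  rw [← hun] at hlim
  refine le_of_tendsto' (ENNReal.Tendsto.const_mul hlim (Or.inr ENNReal.ofReal_ne_top))
    fun n => (mul_measure_closedBall_lt_one m ?_ ?_).le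
  · have : 1 / ((n : ℝ) + 1) ≤ 1 := by
      rw [div_le_one (by positivity)]
      have : (0 : ℝ) ≤ n := by positivity
      linarith
    nlinarith
  · have : 0 < levelRadius m c x * (1 / ((n : ℝ) + 1)) := by positivity
    linarith

variable [CompactSpace T] [IsProbabilityMeasure m]

lemma levelRadius_set_nonempty (hc : 1 ≤ c) (x : T) :
    {ε : ℝ | 0 ≤ ε ∧ 1 ≤ ENNReal.ofReal c * m (Metric.closedBall x ε)}.Nonempty := by
  refine ⟨Metric.diam (Set.univ : Set T), Metric.diam_nonneg, ?_⟩
  have : Metric.closedBall x (Metric.diam (Set.univ : Set T)) = Set.univ :=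
    Set.eq_univ_of_forall fun y =>
      Metric.dist_le_diam_of_mem isCompact_univ.isBounded (Set.mem_univ y) (Set.mem_univ x)
  rw [this, measure_univ, mul_one]
  exact ENNReal.one_le_ofReal.2 hc

variable [BorelSpace T]

lemma one_le_mul_measure_closedBall (hc : 1 ≤ c) (x : T) :
    1 ≤ ENNReal.ofReal c * m (Metric.closedBall x (levelRadius m c x)) := by
  have hne := levelRadius_set_nonempty m hc x
  have hint : Metric.closedBall x (levelRadius m c x) =
      ⋂ n : ℕ, Metric.closedBall x (levelRadius m c x + 1 / ((n : ℝ) + 1)) := by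
    ext y
    simp only [Set.mem_iInter, Metric.mem_closedBall]
    refine ⟨fun h n => h.trans (by have : (0 : ℝ) < 1 / ((n : ℝ) + 1) := by positivity
                                   linarith), fun h => ?_⟩
    refine ge_of_tendsto' (x := atTop) (f := fun n : ℕ => levelRadius m c x + 1 / ((n : ℝ) + 1))
      ?_ h
    simpa using tendsto_const_nhds.add (tendsto_one_div_add_atTop_nhds_zero_nat (𝕜 := ℝ))
  have hlim := tendsto_measure_iInter_atTop (μ := m)
    (s := fun n : ℕ => Metric.closedBall x (levelRadius m c x + 1 / ((n : ℝ) + 1)))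
    (fun n => Metric.isClosed_closedBall.measurableSet.nullMeasurableSet)
    (fun i j hij => Metric.closedBall_subset_closedBall (by
      have : 1 / ((j : ℝ) + 1) ≤ 1 / ((i : ℝ) + 1) := one_div_le_one_div_of_le (by positivity)
        (by have : (i : ℝ) ≤ j := by exact_mod_cast hij
            linarith)
      linarith)) ⟨0, measure_ne_top _ _⟩
  rw [← hint] at hlim
  refine ge_of_tendsto' (ENNReal.Tendsto.const_mul hlim (Or.inr ENNReal.ofReal_ne_top))
    fun n => ?_
  obtain ⟨ε, ⟨-, hε⟩, hlt⟩ := exists_lt_of_csInf_lt hne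
    (show sInf _ < levelRadius m c x + 1 / ((n : ℝ) + 1) from
      lt_add_of_pos_right _ (by positivity))
  refine hε.trans ?_
  gcongr
  exact measure_mono (Metric.closedBall_subset_closedBall hlt.le)

lemma levelRadius_le_add_dist (hc : 1 ≤ c) (x y : T) :
    levelRadius m c x ≤ levelRadius m c y + dist x y := by
  refine levelRadius_le m (add_nonneg (levelRadius_nonneg m c y) dist_nonneg) ?_
  refine (one_le_mul_measure_closedBall m hc y).trans ?_
  gcongr
  exact Metric.closedBall_subset_closedBall' (by rw [dist_comm y x])

lemma continuous_levelRadius (hc : 1 ≤ c) : Continuous (levelRadius m c) :=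
  (LipschitzWith.of_le_add (levelRadius_le_add_dist m hc)).continuous

end LevelRadius

/-! ### Weights on `T × T` and the energy of a function -/

/-- The density, in its second variable, of the normalized restriction of `m` to the closed ball
around `u` of radius `levelRadius m c u`. -/
def ballWeight {T : Type*} [MetricSpace T] [MeasurableSpace T] (m : Measure T) (c : ℝ) (u v : T) :
    ℝ≥0∞ :=
  if dist u v ≤ levelRadius m c u then (m (Metric.closedBall u (levelRadius m c u)))⁻¹ else 0

/-- The constant `Φ k` on the strip `d(u, v) < r_k(u)`, where `r_k` is the level radius of `Φ k`;
for `k = 0` the strip is replaced by all of `T × T`. -/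
def stripWeight {T : Type*} [MetricSpace T] [MeasurableSpace T] (m : Measure T) (Φ : ℕ → ℝ) (k : ℕ)
    (u v : T) : ℝ≥0∞ :=
  open Classical in
  if k = 0 ∨ dist u v < levelRadius m (Φ k) u then ENNReal.ofReal (Φ k) else 0

/-- The integral of `ψ (f^d)` against the weight `w`. -/
def energy {T : Type*} [MetricSpace T] [MeasurableSpace T] (m : Measure T) (ψ : ℝ → ℝ)
    (w : T → T → ℝ≥0∞) (f : T → ℝ) : ℝ≥0∞ :=
  ∫⁻ u, ∫⁻ v, w u v * ENNReal.ofReal (ψ (|f u - f v| / dist u v)) ∂m ∂m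

section Weights

variable {T : Type*} [MetricSpace T] [MeasurableSpace T] [BorelSpace T]
  (m : Measure T) [IsProbabilityMeasure m] {c : ℝ}

lemma lintegral_stripWeight_le {Φ : ℕ → ℝ} (hΦ0 : Φ 0 = 1) (k : ℕ) (u : T) :
    ∫⁻ v, stripWeight m Φ k u v ∂m ≤ 1 := by
  rcases Nat.eq_zero_or_pos k with rfl | hk
  · simp [stripWeight, hΦ0]
  · have h : (fun v => stripWeight m Φ k u v) =
        (Metric.ball u (levelRadius m (Φ k) u)).indicator fun _ => ENNReal.ofReal (Φ k) := by
      classical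
      ext v
      simp [stripWeight, Set.indicator_apply, dist_comm, hk.ne']
    rw [h, lintegral_indicator Metric.isOpen_ball.measurableSet, setLIntegral_const]
    exact mul_measure_ball_levelRadius_le m u

variable [CompactSpace T]

lemma secondCountable_of_compactSpace (T : Type*) [MetricSpace T] [CompactSpace T] :
    SecondCountableTopology T :=
  UniformSpace.secondCountable_of_separable T

lemma ballWeight_le (hc : 1 ≤ c) (u v : T) : ballWeight m c u v ≤ ENNReal.ofReal c := by
  unfold ballWeight
  split_ifs
  · rw [ENNReal.inv_le_iff_le_mul (fun h => absurd h ENNReal.ofReal_ne_top)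
      (fun h => absurd h (measure_ne_top _ _)), mul_comm]
    exact one_le_mul_measure_closedBall m hc u
  · exact zero_le

lemma measurable_ballWeight (hc : 1 ≤ c) :
    Measurable fun p : T × T => ballWeight m c p.1 p.2 := by
  have := secondCountable_of_compactSpace T
  have hcont := continuous_levelRadius m hc
  have hset : MeasurableSet {p : T × T | dist p.1 p.2 ≤ levelRadius m c p.1} :=
    (isClosed_le continuous_dist (hcont.comp continuous_fst)).measurableSet
  refine Measurable.ite hset ?_ measurable_const
  have h := measurable_measure_prodMk_left (ν := m) hset
  have h' : Measurable fun u : T => (m (Metric.closedBall u (levelRadius m c u)))⁻¹ := by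
    refine Measurable.inv ?_
    convert h using 3 with u
    ext v
    simp [dist_comm]
  exact h'.comp measurable_fst

lemma lintegral_ballWeight (hc : 1 ≤ c) (u : T) : ∫⁻ v, ballWeight m c u v ∂m = 1 := by
  have h : (fun v => ballWeight m c u v) =
      (Metric.closedBall u (levelRadius m c u)).indicator
        fun _ => (m (Metric.closedBall u (levelRadius m c u)))⁻¹ := by
    classical
    ext v
    simp [ballWeight, Set.indicator_apply, dist_comm]
  rw [h, lintegral_indicator Metric.isClosed_closedBall.measurableSet, setLIntegral_const]
  refine ENNReal.inv_mul_cancel (fun h0 => ?_) (measure_ne_top _ _)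
  have := one_le_mul_measure_closedBall m hc u
  simp [h0] at this

lemma measurable_stripWeight {Φ : ℕ → ℝ} (hΦ : ∀ k, 1 ≤ Φ k) (k : ℕ) :
    Measurable fun p : T × T => stripWeight m Φ k p.1 p.2 := by
  have := secondCountable_of_compactSpace T
  have hcont := continuous_levelRadius m (hΦ k)
  have hset : MeasurableSet {p : T × T | k = 0 ∨ dist p.1 p.2 < levelRadius m (Φ k) p.1} :=
    (MeasurableSet.const (k = 0)).union
      (isOpen_lt continuous_dist (hcont.comp continuous_fst)).measurableSet
  exact Measurable.ite hset measurable_const measurable_const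

end Weights

/-! ### Increments of functions with finite energy -/

section Increments

variable {φ ψ : ℝ → ℝ}

lemma IsYoungFunction.one_le_map (hψ : IsYoungFunction ψ) (hψ1 : ψ 1 = 1) {A : ℝ}
    (hA : 1 ≤ A) : 1 ≤ ψ A :=
  hψ1 ▸ hψ.1 (Set.mem_Ici.2 zero_le_one) (Set.mem_Ici.2 (zero_le_one.trans hA)) hA

lemma IsYoungFunction.nonneg (hψ : IsYoungFunction ψ) {x : ℝ} (hx : 0 ≤ x) : 0 ≤ ψ x :=
  hψ.2.2.1 ▸ hψ.1 (Set.mem_Ici.2 le_rfl) (Set.mem_Ici.2 hx) hx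

lemma IsYoungFunction.measurable_comp (hψ : IsYoungFunction ψ) {α : Type*} [MeasurableSpace α]
    {h : α → ℝ} (hh : Measurable h) (h0 : ∀ a, 0 ≤ h a) : Measurable fun a => ψ (h a) := by
  have hmono : Monotone fun x : ℝ => ψ (max x 0) := fun x y hxy =>
    hψ.1 (Set.mem_Ici.2 (le_max_right _ _)) (Set.mem_Ici.2 (le_max_right _ _))
      (max_le_max hxy le_rfl)
  have := hmono.measurable.comp hh
  simpa [Function.comp_def, h0] using this

lemma IsYoungFunction.map_mul_le (hψ : IsYoungFunction ψ) {a x : ℝ} (ha0 : 0 ≤ a) (ha1 : a ≤ 1)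
    (hx : 0 ≤ x) : ψ (a * x) ≤ a * ψ x := by
  have := hψ.2.1.2 (Set.mem_Ici.2 hx) (Set.mem_Ici.2 le_rfl) ha0 (sub_nonneg.2 ha1)
    (add_sub_cancel a 1)
  simpa [hψ.2.2.1] using this

lemma IsYoungFunction.le_mul_one_add_div (hψ : IsYoungFunction ψ) (hψ1 : ψ 1 = 1) {A z : ℝ}
    (hA : 1 ≤ A) (hz : 0 ≤ z) : z ≤ A * (1 + ψ z / ψ A) := by
  have hA0 : 0 < A := zero_lt_one.trans_le hA
  have hψA : 0 < ψ A := zero_lt_one.trans_le (hψ.one_le_map hψ1 hA)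
  rcases le_or_gt z A with h | h
  · have : 0 ≤ ψ z / ψ A := div_nonneg (hψ.nonneg hz) hψA.le
    nlinarith
  · have hz0 : 0 < z := hA0.trans h
    have h1 := hψ.map_mul_le (a := A / z) (by positivity) ((div_le_one hz0).2 h.le) hz
    rw [div_mul_cancel₀ _ hz0.ne', div_mul_eq_mul_div, le_div_iff₀ hz0] at h1
    have h2 : z ≤ A * (ψ z / ψ A) := by
      rw [mul_div_assoc', le_div_iff₀ hψA]
      linarith
    linarith

variable {T : Type*} [MetricSpace T] [CompactSpace T] [MeasurableSpace T] [BorelSpace T]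
  {m : Measure T} [IsProbabilityMeasure m]

lemma measurable_young_increment (hψ : IsYoungFunction ψ) {f : T → ℝ} (hf : Continuous f) :
    Measurable fun p : T × T => ENNReal.ofReal (ψ (|f p.1 - f p.2| / dist p.1 p.2)) := by
  have := secondCountable_of_compactSpace T
  refine (hψ.measurable_comp (Measurable.div ?_ ?_) fun p =>
    div_nonneg (abs_nonneg _) dist_nonneg).ennreal_ofReal
  · exact (((hf.comp continuous_fst).sub (hf.comp continuous_snd)).abs).measurable
  · exact continuous_dist.measurable

omit [CompactSpace T] [BorelSpace T] [MeasurableSpace T] in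
lemma ofReal_abs_sub_le (hψ : IsYoungFunction ψ) (hψ1 : ψ 1 = 1) {A D : ℝ} (hA : 1 ≤ A)
    (f : T → ℝ) {u v : T} (hD : dist u v ≤ D) :
    ENNReal.ofReal |f u - f v| ≤ ENNReal.ofReal (D * A) *
      (1 + ENNReal.ofReal (1 / ψ A) * ENNReal.ofReal (ψ (|f u - f v| / dist u v))) := by
  have hψA : 0 < ψ A := zero_lt_one.trans_le (hψ.one_le_map hψ1 hA)
  have hz : 0 ≤ |f u - f v| / dist u v := by positivity
  have hD0 : 0 ≤ D := dist_nonneg.trans hD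
  have hA0 : 0 ≤ A := zero_le_one.trans hA
  have hψz := hψ.nonneg hz
  rw [← ENNReal.ofReal_mul (by positivity), ← ENNReal.ofReal_one,
    ← ENNReal.ofReal_add zero_le_one (by positivity), ← ENNReal.ofReal_mul (by positivity)]
  refine ENNReal.ofReal_le_ofReal ?_
  rcases eq_or_ne u v with rfl | huv
  · exact (by simp : |f u - f u| ≤ 0).trans (by positivity)
  · have hd : 0 < dist u v := dist_pos.2 huv
    calc |f u - f v| = dist u v * (|f u - f v| / dist u v) := by field_simp
      _ ≤ D * (A * (1 + ψ (|f u - f v| / dist u v) / ψ A)) :=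
        mul_le_mul hD (hψ.le_mul_one_add_div hψ1 hA hz) hz hD0
      _ = _ := by ring

lemma lintegral_mul_abs_sub_le (hψ : IsYoungFunction ψ) (hψ1 : ψ 1 = 1) {A D c : ℝ} (hA : 1 ≤ A)
    {f : T → ℝ} (hf : Continuous f) {q w : T → T → ℝ≥0∞}
    (hq : Measurable fun p : T × T => q p.1 p.2) (hw : Measurable fun p : T × T => w p.1 p.2)
    (hq1 : ∫⁻ u, ∫⁻ v, q u v ∂m ∂m ≤ 1) (hqD : ∀ u v, q u v ≠ 0 → dist u v ≤ D)
    (hqw : ∀ u v, q u v ≤ ENNReal.ofReal c * w u v) :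
    ∫⁻ u, ∫⁻ v, q u v * ENNReal.ofReal |f u - f v| ∂m ∂m ≤
      ENNReal.ofReal (D * A) * (1 + ENNReal.ofReal (c / ψ A) * energy m ψ w f) := by
  have hψA : 0 < ψ A := zero_lt_one.trans_le (hψ.one_le_map hψ1 hA)
  have hg := measurable_young_increment hψ hf
  set g : T → T → ℝ≥0∞ := fun u v => ENNReal.ofReal (ψ (|f u - f v| / dist u v))
  have hpt : ∀ u v, q u v * ENNReal.ofReal |f u - f v| ≤
      ENNReal.ofReal (D * A) * (q u v + ENNReal.ofReal (c / ψ A) * (w u v * g u v)) := by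
    intro u v
    by_cases h0 : q u v = 0
    · simp [h0]
    calc q u v * ENNReal.ofReal |f u - f v|
        ≤ q u v * (ENNReal.ofReal (D * A) * (1 + ENNReal.ofReal (1 / ψ A) * g u v)) := by
          gcongr
          exact ofReal_abs_sub_le hψ hψ1 hA f (hqD u v h0)
      _ = ENNReal.ofReal (D * A) * (q u v + ENNReal.ofReal (1 / ψ A) * (q u v * g u v)) := by ring
      _ ≤ ENNReal.ofReal (D * A) *
          (q u v + ENNReal.ofReal (1 / ψ A) * ((ENNReal.ofReal c * w u v) * g u v)) := by
          gcongr
          exact hqw u v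
      _ = _ := by
          rw [show c / ψ A = 1 / ψ A * c by ring,
            ENNReal.ofReal_mul (one_div_nonneg.2 hψA.le)]
          ring
  have hwg : Measurable fun p : T × T => w p.1 p.2 * g p.1 p.2 := hw.mul hg
  calc ∫⁻ u, ∫⁻ v, q u v * ENNReal.ofReal |f u - f v| ∂m ∂m
      ≤ ∫⁻ u, ∫⁻ v, ENNReal.ofReal (D * A) *
          (q u v + ENNReal.ofReal (c / ψ A) * (w u v * g u v)) ∂m ∂m :=
        lintegral_mono fun u => lintegral_mono fun v => hpt u v
    _ = ∫⁻ u, ENNReal.ofReal (D * A) *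
          (∫⁻ v, q u v ∂m + ENNReal.ofReal (c / ψ A) * ∫⁻ v, w u v * g u v ∂m) ∂m := by
        refine lintegral_congr fun u => ?_
        have hqu : Measurable (q u) := hq.comp measurable_prodMk_left
        rw [lintegral_const_mul' _ _ ENNReal.ofReal_ne_top, lintegral_add_left hqu,
          lintegral_const_mul' _ _ ENNReal.ofReal_ne_top]
    _ = ENNReal.ofReal (D * A) *
          (∫⁻ u, ∫⁻ v, q u v ∂m ∂m + ENNReal.ofReal (c / ψ A) * energy m ψ w f) := by
        rw [lintegral_const_mul' _ _ ENNReal.ofReal_ne_top,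
          lintegral_add_left hq.lintegral_prod_right',
          lintegral_const_mul' _ _ ENNReal.ofReal_ne_top, energy]
    _ ≤ _ := by gcongr

/-- Chaining: for a continuous `f`, iterating the averages over balls with level radii from level
`l` down to level `k` yields a density `p`, bounded by `Φ k` and supported near `x`, with controlled
mean increment of `f` from `x`. -/
lemma exists_density_lintegral_abs_sub_le (hψ : IsYoungFunction ψ) (hψ1 : ψ 1 = 1)
    {R : ℝ} (hR : 1 ≤ R) (n₀ : ℕ) {Φ : ℕ → ℝ} (hΦ : ∀ k, 1 ≤ Φ k) {f : T → ℝ} (hf : Continuous f)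
    {Γ : ℝ≥0∞}
    (hΓ : ∀ j, 1 + ENNReal.ofReal (Φ (j + 1) / ψ (R ^ (j + 1 + n₀))) *
      energy m ψ (ballWeight m (Φ j)) f ≤ Γ)
    {x : T} {l : ℕ} {ρ : ℕ → ℝ} (hρ0 : ∀ i, 0 ≤ ρ i) (hρl : levelRadius m (Φ l) x ≤ ρ l)
    (hρ : ∀ i < l, levelRadius m (Φ i) x + 2 * ρ (i + 1) ≤ ρ i) {δ : ℝ}
    (hδ : ∀ u, dist u x ≤ levelRadius m (Φ l) x → |f x - f u| ≤ δ) (n k : ℕ) (hnk : k + n = l) :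
    ∃ p : T → ℝ≥0∞, Measurable p ∧ ∫⁻ u, p u ∂m = 1 ∧ (∀ u, p u ≤ ENNReal.ofReal (Φ k)) ∧
      (∀ u, p u ≠ 0 → dist u x ≤ ρ k) ∧
      ∫⁻ u, p u * ENNReal.ofReal |f x - f u| ∂m ≤ ENNReal.ofReal δ +
        Γ * ENNReal.ofReal (R ^ (n₀ + 1) * ∑ i ∈ Finset.Ico k l, R ^ i * ρ i) := by
  have hR0 : 0 < R := zero_lt_one.trans_le hR
  induction n generalizing k with
  | zero =>
    obtain rfl : k = l := by simpa using hnk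
    have hsupp : ∀ u, ballWeight m (Φ k) x u ≠ 0 → dist u x ≤ levelRadius m (Φ k) x := by
      intro u hu
      by_contra h
      exact hu (if_neg (by rwa [dist_comm]))
    refine ⟨ballWeight m (Φ k) x, (measurable_ballWeight m (hΦ k)).comp measurable_prodMk_left,
      lintegral_ballWeight m (hΦ k) x, ballWeight_le m (hΦ k) x,
      fun u hu => (hsupp u hu).trans hρl, ?_⟩
    refine le_add_right ?_
    calc ∫⁻ u, ballWeight m (Φ k) x u * ENNReal.ofReal |f x - f u| ∂m
        ≤ ∫⁻ u, ballWeight m (Φ k) x u * ENNReal.ofReal δ ∂m := by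
          refine lintegral_mono fun u => ?_
          by_cases h0 : ballWeight m (Φ k) x u = 0
          · simp [h0]
          · gcongr
            exact hδ u (hsupp u h0)
      _ = ENNReal.ofReal δ := by
          rw [lintegral_mul_const' _ _ ENNReal.ofReal_ne_top, lintegral_ballWeight m (hΦ k),
            one_mul]
  | succ n ih =>
    obtain ⟨p, hpm, hp1, hpb, hps, hpf⟩ := ih (k + 1) (by omega)
    have hw := measurable_ballWeight m (hΦ k)
    set w := ballWeight m (Φ k)
    have hq : Measurable fun z : T × T => p z.1 * w z.1 z.2 := (hpm.comp measurable_fst).mul hw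
    have hqw : ∀ u v, p u * w u v ≠ 0 → dist u x ≤ ρ (k + 1) ∧
        dist u v ≤ levelRadius m (Φ k) x + ρ (k + 1) := by
      intro u v huv
      have hu := hps u (left_ne_zero_of_mul huv)
      refine ⟨hu, ?_⟩
      have hv : dist u v ≤ levelRadius m (Φ k) u := by
        by_contra h
        exact right_ne_zero_of_mul huv (if_neg h)
      linarith [levelRadius_le_add_dist m (hΦ k) u x]
    have hρk := hρ k (by omega)
    have hρk1 := hρ0 (k + 1)
    have hone : ∫⁻ u, ∫⁻ v, p u * w u v ∂m ∂m = 1 := by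
      rw [← hp1]
      refine lintegral_congr fun u => ?_
      have hwu : Measurable (w u) := hw.comp measurable_prodMk_left
      rw [lintegral_const_mul _ hwu, lintegral_ballWeight m (hΦ k),
        mul_one]
    have hinc := lintegral_mul_abs_sub_le (m := m) hψ hψ1 (A := R ^ (k + 1 + n₀)) (D := ρ k)
      (c := Φ (k + 1)) (one_le_pow₀ hR) hf hq hw hone.le
      (fun u v h => by linarith [(hqw u v h).2]) (fun u v => by gcongr; exact hpb u)
    have hfm : Measurable fun u => ENNReal.ofReal |f x - f u| :=
      (continuous_const.sub hf).abs.measurable.ennreal_ofReal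
    refine ⟨fun v => ∫⁻ u, p u * w u v ∂m, hq.lintegral_prod_left', ?_, ?_, ?_, ?_⟩
    · rw [← hone]
      exact lintegral_lintegral_swap (hq.comp measurable_swap).aemeasurable
    · intro v
      calc ∫⁻ u, p u * w u v ∂m ≤ ∫⁻ u, p u * ENNReal.ofReal (Φ k) ∂m :=
            lintegral_mono fun u => by
              gcongr
              exact ballWeight_le m (hΦ k) u v
        _ = ENNReal.ofReal (Φ k) := by
            rw [lintegral_mul_const' _ _ ENNReal.ofReal_ne_top, hp1, one_mul]
    · intro v hv
      by_contra h
      refine hv ?_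
      rw [← lintegral_zero (μ := m)]
      refine lintegral_congr fun u => ?_
      by_contra h0
      obtain ⟨h1, h2⟩ := hqw u v h0
      have := dist_triangle_left v x u
      linarith
    · calc ∫⁻ v, (∫⁻ u, p u * w u v ∂m) * ENNReal.ofReal |f x - f v| ∂m
          = ∫⁻ v, ∫⁻ u, p u * w u v * ENNReal.ofReal |f x - f v| ∂m ∂m := by
            refine lintegral_congr fun v => ?_
            rw [lintegral_mul_const' _ _ ENNReal.ofReal_ne_top]
        _ = ∫⁻ u, ∫⁻ v, p u * w u v * ENNReal.ofReal |f x - f v| ∂m ∂m := by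
            refine lintegral_lintegral_swap
              (f := fun v u => p u * w u v * ENNReal.ofReal |f x - f v|) ?_
            exact ((hq.comp measurable_swap).mul (hfm.comp measurable_fst)).aemeasurable
        _ ≤ ∫⁻ u, ∫⁻ v, (p u * ENNReal.ofReal |f x - f u| * w u v +
              p u * w u v * ENNReal.ofReal |f u - f v|) ∂m ∂m := by
            refine lintegral_mono fun u => lintegral_mono fun v => ?_
            calc p u * w u v * ENNReal.ofReal |f x - f v|
                ≤ p u * w u v * (ENNReal.ofReal |f x - f u| + ENNReal.ofReal |f u - f v|) := by
                  rw [← ENNReal.ofReal_add (abs_nonneg _) (abs_nonneg _)]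
                  gcongr
                  exact abs_sub_le _ _ _
              _ = _ := by ring
        _ = ∫⁻ u, p u * ENNReal.ofReal |f x - f u| ∂m +
              ∫⁻ u, ∫⁻ v, p u * w u v * ENNReal.ofReal |f u - f v| ∂m ∂m := by
            have hpf : Measurable fun u => p u * ENNReal.ofReal |f x - f u| := hpm.mul hfm
            rw [← lintegral_add_left hpf]
            refine lintegral_congr fun u => ?_
            have hwu : Measurable (w u) := hw.comp measurable_prodMk_left
            rw [lintegral_add_left (hwu.const_mul _), lintegral_const_mul _ hwu,
              lintegral_ballWeight m (hΦ k), mul_one]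
        _ ≤ (ENNReal.ofReal δ + Γ * ENNReal.ofReal
              (R ^ (n₀ + 1) * ∑ i ∈ Finset.Ico (k + 1) l, R ^ i * ρ i)) +
              ENNReal.ofReal (ρ k * R ^ (k + 1 + n₀)) * Γ :=
            add_le_add hpf (hinc.trans (by gcongr; exact hΓ k))
        _ = _ := by
            have hs : 0 ≤ ∑ i ∈ Finset.Ico (k + 1) l, R ^ i * ρ i :=
              Finset.sum_nonneg fun i _ => mul_nonneg (by positivity) (hρ0 i)
            have hk0 := hρ0 k
            rw [Finset.sum_eq_sum_Ico_succ_bot (by omega : k < l), mul_add,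
              ENNReal.ofReal_add (by positivity) (by positivity),
              show ρ k * R ^ (k + 1 + n₀) = R ^ (n₀ + 1) * (R ^ k * ρ k) by ring]
            ring

end Increments

/-! ### Pathwise bound by the minorizing metric -/

lemma sum_range_succ_pow_le {R : ℝ} (hR : 2 ≤ R) (n : ℕ) :
    ∑ i ∈ Finset.range (n + 1), R ^ i ≤ 2 * R ^ n := by
  induction n with
  | zero => simp
  | succ n ih =>
    rw [Finset.sum_range_succ, pow_succ R n]
    nlinarith [pow_nonneg (zero_le_two.trans hR) n]

lemma exists_backward_recursion {b : ℕ → ℝ} (hb : ∀ i, 0 ≤ b i) (l : ℕ) :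
    ∃ ρ : ℕ → ℝ, ρ (l + 1) = 0 ∧ (∀ i, 0 ≤ ρ i) ∧ ∀ i ≤ l, ρ i = b i + 2 * ρ (i + 1) := by
  let g : ℕ → ℝ := fun n => n.rec 0 fun n y => b (l - n) + 2 * y
  have hg : ∀ n, 0 ≤ g n := fun n => by
    induction n with
    | zero => exact le_refl (0 : ℝ)
    | succ n ih => exact add_nonneg (hb _) (mul_nonneg zero_le_two ih)
  refine ⟨fun i => g (l + 1 - i), by simp [g], fun i => hg _, fun i hi => ?_⟩
  obtain ⟨n, rfl⟩ := Nat.exists_eq_add_of_le hi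
  have h1 : i + n + 1 - i = n + 1 := by omega
  have h2 : i + n + 1 - (i + 1) = n := by omega
  simp only [h1, h2, g]
  congr 2
  omega

lemma sum_pow_mul_add_le {R : ℝ} (hR : 10 ≤ R) {a ρ : ℕ → ℝ} {l : ℕ} (hρl : ρ (l + 1) = 0)
    (hρ0 : ∀ i, 0 ≤ ρ i) (n k : ℕ) (hnk : k + n = l + 1)
    (h : ∀ i, k ≤ i → i ≤ l → ρ i ≤ 2 * a i + 5 * ρ (i + 1)) :
    ∑ i ∈ Finset.Ico k (l + 1), R ^ i * ρ i + R ^ k * ρ k ≤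
      4 * ∑ i ∈ Finset.Ico k (l + 1), R ^ i * a i := by
  induction n generalizing k with
  | zero =>
    obtain rfl : k = l + 1 := by simpa using hnk
    simp [hρl]
  | succ n ih =>
    have hk : k < l + 1 := by omega
    rw [Finset.sum_eq_sum_Ico_succ_bot hk, Finset.sum_eq_sum_Ico_succ_bot hk]
    have h1 := ih (k + 1) (by omega) fun i hi => h i (by omega)
    have h2 := h k le_rfl (by omega)
    have hRk : 0 < R ^ k := by positivity
    have h3 := mul_le_mul_of_nonneg_left h2 hRk.le
    have h4 : 10 * (R ^ k * ρ (k + 1)) ≤ R ^ (k + 1) * ρ (k + 1) := by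
      rw [pow_succ]
      nlinarith [mul_nonneg hRk.le (hρ0 (k + 1))]
    linarith

section Pathwise

variable {φ ψ : ℝ → ℝ} {T : Type*} [MetricSpace T] [MeasurableSpace T]
  {m : Measure T}

lemma IsYoungFunction.one_le_yinv (hφ : IsYoungFunction φ) (hφ1 : φ 1 = 1) {y : ℝ≥0∞}
    (hy : 1 ≤ y) : 1 ≤ yinv φ y := by
  refine le_sInf ?_
  rintro _ ⟨r, hr, rfl, h⟩
  rw [ENNReal.one_le_ofReal]
  by_contra! hr1
  have h1 := hφ.map_mul_le hr hr1.le zero_le_one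
  rw [mul_one, hφ1, mul_one] at h1
  have h2 := ENNReal.one_le_ofReal.1 (hy.trans h)
  linarith

variable [IsProbabilityMeasure m]

lemma ofReal_le_yinv (hφ : IsYoungFunction φ) {a : ℝ} (ha : 0 ≤ a) {x : T} {ε : ℝ}
    (hε : 0 ≤ ε) (h : ε < levelRadius m (φ a) x) :
    ENNReal.ofReal a ≤ yinv φ (1 / m (Metric.closedBall x ε)) := by
  refine le_sInf ?_
  rintro _ ⟨r, hr, rfl, hle⟩
  refine ENNReal.ofReal_le_ofReal ?_
  by_contra! hra
  have h1 : 1 / m (Metric.closedBall x ε) ≤ ENNReal.ofReal (φ a) :=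
    hle.trans (ENNReal.ofReal_le_ofReal (hφ.1 (Set.mem_Ici.2 hr) (Set.mem_Ici.2 ha) hra.le))
  rw [ENNReal.div_le_iff_le_mul (Or.inr ENNReal.ofReal_ne_top) (Or.inl (measure_ne_top _ _))] at h1
  exact absurd h1 (not_le.2 (mul_measure_closedBall_lt_one m hε h))

lemma sum_ofReal_mul_min_le (hφ : IsYoungFunction φ) {R : ℝ} (hR : 2 ≤ R) (x : T) (d : ℝ) (n : ℕ) :
    ∑ i ∈ Finset.range n, ENNReal.ofReal (R ^ i * min (levelRadius m (φ (R ^ i)) x) d) ≤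
      2 * ∫⁻ ε in Set.Ioc (0 : ℝ) d, yinv φ (1 / m (Metric.closedBall x ε)) := by
  have hR0 : 0 ≤ R := zero_le_two.trans hR
  calc ∑ i ∈ Finset.range n, ENNReal.ofReal (R ^ i * min (levelRadius m (φ (R ^ i)) x) d)
      ≤ ∑ i ∈ Finset.range n, ∫⁻ ε in Set.Ioc (0 : ℝ) d,
          (Set.Iio (levelRadius m (φ (R ^ i)) x)).indicator (fun _ => ENNReal.ofReal (R ^ i)) ε := by
        refine Finset.sum_le_sum fun i _ => ?_
        rw [lintegral_indicator measurableSet_Iio, setLIntegral_const,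
          Measure.restrict_apply measurableSet_Iio, ENNReal.ofReal_mul (by positivity)]
        gcongr
        rw [show ENNReal.ofReal (min (levelRadius m (φ (R ^ i)) x) d) =
          volume (Set.Ioo 0 (min (levelRadius m (φ (R ^ i)) x) d)) by simp]
        refine measure_mono fun ε hε => ⟨hε.2.trans_le (min_le_left _ _), hε.1,
          (hε.2.trans_le (min_le_right _ _)).le⟩
    _ = ∫⁻ ε in Set.Ioc (0 : ℝ) d, ∑ i ∈ Finset.range n,
          (Set.Iio (levelRadius m (φ (R ^ i)) x)).indicator (fun _ => ENNReal.ofReal (R ^ i)) ε :=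
        (lintegral_finsetSum _ fun i _ => measurable_const.indicator measurableSet_Iio).symm
    _ ≤ ∫⁻ ε in Set.Ioc (0 : ℝ) d, 2 * yinv φ (1 / m (Metric.closedBall x ε)) := by
        refine setLIntegral_mono' measurableSet_Ioc fun ε hε => ?_
        induction n with
        | zero => simp
        | succ n ih =>
          by_cases h : ε < levelRadius m (φ (R ^ n)) x
          · calc ∑ i ∈ Finset.range (n + 1), (Set.Iio (levelRadius m (φ (R ^ i)) x)).indicator
                  (fun _ => ENNReal.ofReal (R ^ i)) ε
                ≤ ∑ i ∈ Finset.range (n + 1), ENNReal.ofReal (R ^ i) :=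
                  Finset.sum_le_sum fun i _ => Set.indicator_le_self _ _ _
              _ = ENNReal.ofReal (∑ i ∈ Finset.range (n + 1), R ^ i) :=
                  (ENNReal.ofReal_sum_of_nonneg fun i _ => by positivity).symm
              _ ≤ ENNReal.ofReal (2 * R ^ n) :=
                  ENNReal.ofReal_le_ofReal (sum_range_succ_pow_le hR n)
              _ = 2 * ENNReal.ofReal (R ^ n) := by
                  rw [ENNReal.ofReal_mul zero_le_two, ENNReal.ofReal_ofNat]
              _ ≤ _ := by
                  gcongr
                  exact ofReal_le_yinv hφ (by positivity) hε.1.le h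
          · rw [Finset.sum_range_succ, Set.indicator_of_notMem (by simpa using h), add_zero]
            exact ih
    _ = _ := lintegral_const_mul' _ _ (by simp)

lemma ofReal_dist_le_tauDist (hφ : IsYoungFunction φ) (hφ1 : φ 1 = 1) (s t : T) :
    ENNReal.ofReal (dist s t) ≤ tauDist m φ s t := by
  refine le_max_of_le_left ?_
  calc ENNReal.ofReal (dist s t) = ∫⁻ _ in Set.Ioc (0 : ℝ) (dist s t), 1 := by simp
    _ ≤ _ := lintegral_mono fun ε => hφ.one_le_yinv hφ1 (by
        rw [one_div]
        exact ENNReal.one_le_inv.2 prob_le_one)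

lemma sum_mul_min_le_toReal_tauDist (hφ : IsYoungFunction φ) {R : ℝ} (hR : 2 ≤ R) {s t : T}
    (hτ : tauDist m φ s t ≠ ∞) (n : ℕ) {x : T} (hx : x = s ∨ x = t) :
    ∑ i ∈ Finset.range n, R ^ i * min (levelRadius m (φ (R ^ i)) x) (dist s t) ≤
      2 * (tauDist m φ s t).toReal := by
  have hR0 : 0 ≤ R := zero_le_two.trans hR
  have h0 : ∀ i, 0 ≤ R ^ i * min (levelRadius m (φ (R ^ i)) x) (dist s t) := fun i =>
    mul_nonneg (by positivity) (le_min (levelRadius_nonneg _ _ _) dist_nonneg)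
  have h : ENNReal.ofReal
      (∑ i ∈ Finset.range n, R ^ i * min (levelRadius m (φ (R ^ i)) x) (dist s t)) ≤
      2 * tauDist m φ s t := by
    rw [ENNReal.ofReal_sum_of_nonneg fun i _ => h0 i]
    refine (sum_ofReal_mul_min_le hφ hR x (dist s t) n).trans ?_
    gcongr
    rcases hx with rfl | rfl
    · exact le_max_left _ _
    · exact le_max_right _ _
  have := (ENNReal.ofReal_le_iff_le_toReal (ENNReal.mul_ne_top (by simp) hτ)).1 h
  simpa using this

variable [CompactSpace T] [BorelSpace T]

omit [IsProbabilityMeasure m] in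
lemma ofReal_abs_sub_le_lintegral_add {f : T → ℝ} (hf : Continuous f) (s t : T) {p q : T → ℝ≥0∞}
    (hp : Measurable p) (hq : Measurable q) (hp1 : ∫⁻ u, p u ∂m = 1) (hq1 : ∫⁻ u, q u ∂m = 1) :
    ENNReal.ofReal |f s - f t| ≤ ∫⁻ u, p u * ENNReal.ofReal |f s - f u| ∂m +
      ∫⁻ u, ∫⁻ v, p u * q v * ENNReal.ofReal |f u - f v| ∂m ∂m +
      ∫⁻ v, q v * ENNReal.ofReal |f t - f v| ∂m := by
  have := secondCountable_of_compactSpace T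
  have hm : ∀ x, Measurable fun u => ENNReal.ofReal |f x - f u| := fun x =>
    (continuous_const.sub hf).abs.measurable.ennreal_ofReal
  have hm2 : Measurable fun z : T × T => ENNReal.ofReal |f z.1 - f z.2| :=
    ((hf.comp continuous_fst).sub (hf.comp continuous_snd)).abs.measurable.ennreal_ofReal
  have hpf : Measurable fun u => p u * ENNReal.ofReal |f s - f u| := hp.mul (hm s)
  have hqf : Measurable fun v => q v * ENNReal.ofReal |f t - f v| := hq.mul (hm t)
  have hpq : Measurable fun z : T × T => p z.1 * q z.2 * ENNReal.ofReal |f z.1 - f z.2| :=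
    ((hp.comp measurable_fst).mul (hq.comp measurable_snd)).mul hm2
  calc ENNReal.ofReal |f s - f t|
      = ∫⁻ u, ∫⁻ v, p u * (q v * ENNReal.ofReal |f s - f t|) ∂m ∂m := by
        simp_rw [lintegral_const_mul _ (hq.mul_const _), lintegral_mul_const _ hq,
          lintegral_mul_const _ hp, hp1, hq1, one_mul]
    _ ≤ ∫⁻ u, ∫⁻ v, (p u * ENNReal.ofReal |f s - f u| * q v +
          p u * q v * ENNReal.ofReal |f u - f v| +
          p u * (q v * ENNReal.ofReal |f t - f v|)) ∂m ∂m := by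
        refine lintegral_mono fun u => lintegral_mono fun v => ?_
        calc p u * (q v * ENNReal.ofReal |f s - f t|)
            ≤ p u * (q v * (ENNReal.ofReal |f s - f u| + ENNReal.ofReal |f u - f v| +
                ENNReal.ofReal |f t - f v|)) := by
              rw [← ENNReal.ofReal_add (abs_nonneg _) (abs_nonneg _),
                ← ENNReal.ofReal_add (by positivity) (abs_nonneg _)]
              gcongr
              have h1 := abs_sub_le (f s) (f u) (f t)
              have h2 := abs_sub_le (f u) (f v) (f t)
              rw [abs_sub_comm (f v)] at h2
              linarith
          _ = _ := by ring
    _ = ∫⁻ u, (p u * ENNReal.ofReal |f s - f u| +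
          ∫⁻ v, p u * q v * ENNReal.ofReal |f u - f v| ∂m +
          p u * ∫⁻ v, q v * ENNReal.ofReal |f t - f v| ∂m) ∂m := by
        refine lintegral_congr fun u => ?_
        have hpqu : Measurable fun v => p u * q v * ENNReal.ofReal |f u - f v| :=
          hpq.comp measurable_prodMk_left
        rw [lintegral_add_right _ (hqf.const_mul _), lintegral_add_right _ hpqu,
          lintegral_const_mul _ hq, lintegral_const_mul _ hqf, hq1, mul_one]
    _ = _ := by
        rw [lintegral_add_right _ (hp.mul_const _), lintegral_add_left hpf,
          lintegral_mul_const _ hp, hp1, one_mul]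

/-- If `Γ` dominates the weighted energies of a continuous function `f`, then the increments of `f`
are bounded by `Γ` times the minorizing metric, up to a constant. -/
theorem ofReal_abs_sub_le_mul_tauDist (hφ : IsYoungFunction φ) (hψ : IsYoungFunction ψ)
    (hφ1 : φ 1 = 1) (hψ1 : ψ 1 = 1) {R : ℝ} (hR : 10 ≤ R) (n₀ : ℕ)
    (hlc : ∀ k : ℕ, φ (R ^ (k + 1)) ^ 2 ≤ φ (R ^ k) * φ (R ^ (k + 2)))
    {f : T → ℝ} (hf : Continuous f) {Γ : ℝ≥0∞}
    (hΓ : ∀ j, 1 + ENNReal.ofReal (φ (R ^ (j + 1)) / ψ (R ^ (j + 1 + n₀))) *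
      energy m ψ (ballWeight m (φ (R ^ j))) f ≤ Γ)
    (hΓ' : ∀ j, 1 + ENNReal.ofReal (φ (R ^ (j + 2)) / ψ (R ^ (j + 2 + n₀))) *
      energy m ψ (stripWeight m (fun k => φ (R ^ k)) j) f ≤ Γ) (s t : T) :
    ENNReal.ofReal |f s - f t| ≤
      Γ * (ENNReal.ofReal (R ^ (n₀ + 1) * (64 + 2 * R)) * tauDist m φ s t) := by
  rcases eq_or_ne s t with rfl | hst
  · simp
  have hR0 : 0 < R := by linarith
  have hR1 : 1 ≤ R := by linarith
  have hC : 0 < R ^ (n₀ + 1) * (64 + 2 * R) := by positivity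
  have hΓ0 : Γ ≠ 0 := fun h => by simpa [h] using hΓ 0
  rcases eq_or_ne (tauDist m φ s t) ∞ with hτ | hτ
  · rw [hτ, ENNReal.mul_top (by simpa using hC), ENNReal.mul_top hΓ0]
    exact le_top
  have hsum := fun (n : ℕ) {x : T} (hx : x = s ∨ x = t) =>
    sum_mul_min_le_toReal_tauDist hφ (by linarith : 2 ≤ R) hτ n hx
  have hdτ : dist s t ≤ (tauDist m φ s t).toReal :=
    (ENNReal.ofReal_le_iff_le_toReal hτ).1 (ofReal_dist_le_tauDist hφ hφ1 s t)
  rw [show tauDist m φ s t = ENNReal.ofReal (tauDist m φ s t).toReal from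
    (ENNReal.ofReal_toReal hτ).symm]
  set τ := (tauDist m φ s t).toReal
  set d := dist s t
  have hd : 0 < d := dist_pos.2 hst
  have hτ0 : 0 < τ := hd.trans_le hdτ
  set Φ : ℕ → ℝ := fun k => φ (R ^ k) with hΦdef
  have hΦ : ∀ k, 1 ≤ Φ k := fun k => hφ.one_le_map hφ1 (one_le_pow₀ hR1)
  have hr0 : ∀ i x, 0 ≤ levelRadius m (Φ i) x := fun i x => levelRadius_nonneg m _ x
  have hmin0 : ∀ i x, 0 ≤ R ^ i * min (levelRadius m (Φ i) x) d := fun i x =>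
    mul_nonneg (by positivity) (le_min (hr0 i x) hd.le)
  have hterm : ∀ i x, (x = s ∨ x = t) → R ^ i * min (levelRadius m (Φ i) x) d ≤ 2 * τ :=
    fun i x hx => (Finset.single_le_sum (f := fun i => R ^ i * min (levelRadius m (Φ i) x) d)
      (fun i _ => hmin0 i x) (Finset.self_mem_range_succ i)).trans (hsum (i + 1) hx)
  refine ENNReal.le_of_forall_pos_le_add fun ε hε _ => ?_
  have hε' : (0 : ℝ) < ε / 2 := by positivity
  obtain ⟨η₁, hη₁, hs⟩ := Metric.continuous_iff.1 hf s (ε / 2) hε'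
  obtain ⟨η₂, hη₂, ht⟩ := Metric.continuous_iff.1 hf t (ε / 2) hε'
  set η := min (min η₁ η₂) d
  have hη : 0 < η := lt_min (lt_min hη₁ hη₂) hd
  obtain ⟨l, hl, hl1⟩ := (((tendsto_pow_atTop_atTop_of_one_lt
    (by linarith : (1 : ℝ) < R)).eventually_gt_atTop (2 * τ / η)).and
      (eventually_ge_atTop 1)).exists
  have hrl : ∀ x, (x = s ∨ x = t) → levelRadius m (Φ l) x < η := by
    intro x hx
    rw [div_lt_iff₀ hη] at hl
    have h2 : min (levelRadius m (Φ l) x) d < η :=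
      lt_of_mul_lt_mul_left ((hterm l x hx).trans_lt hl) (by positivity)
    rcases min_lt_iff.1 h2 with h | h
    · exact h
    · exact absurd (min_le_right _ _) (not_le.2 h)
  obtain ⟨ρ, hρl, hρ0, hρ⟩ := exists_backward_recursion
    (b := fun i => max (levelRadius m (Φ i) s) (levelRadius m (Φ i) t))
    (fun i => (hr0 i s).trans (le_max_left _ _)) l
  classical
  set P : ℕ → Prop := fun k => k = 1 ∨ d + 3 * ρ k < levelRadius m (Φ (k - 1)) s with hPdef
  obtain ⟨k, hkl, hk1, hPk, hmax⟩ : ∃ k ≤ l, 1 ≤ k ∧ P k ∧ ∀ i, k < i → i ≤ l → ¬ P i :=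
    ⟨Nat.findGreatest P l, Nat.findGreatest_le l, Nat.le_findGreatest hl1 (Or.inl rfl),
      Nat.findGreatest_spec hl1 (Or.inl rfl), fun i h1 h2 => Nat.findGreatest_is_greatest h1 h2⟩
  have hfail : ∀ i, k ≤ i → i ≤ l → levelRadius m (Φ i) s ≤ d + 3 * ρ (i + 1) := by
    intro i hki hil
    rcases hil.eq_or_lt with rfl | hil
    · rw [hρl]
      linarith [hrl s (Or.inl rfl), min_le_right (min η₁ η₂) d]
    · have := hmax (i + 1) (by omega) hil
      simp only [hPdef, not_or, not_lt, Nat.add_sub_cancel] at this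
      exact this.2
  set a : ℕ → ℝ := fun i =>
    min (levelRadius m (Φ i) s) d + min (levelRadius m (Φ i) t) d with hadef
  have hρa : ∀ i, k ≤ i → i ≤ l → ρ i ≤ 2 * a i + 5 * ρ (i + 1) := by
    intro i hki hil
    have h1 := hfail i hki hil
    have h2 := levelRadius_le_add_dist m (hΦ i) t s
    rw [dist_comm t s] at h2
    have h3 := hρ i hil
    have h4 := hρ0 (i + 1)
    have h5 := hr0 i s
    have h6 := hr0 i t
    simp only [hadef]
    rcases max_cases (levelRadius m (Φ i) s) (levelRadius m (Φ i) t) with h | h <;>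
    rcases min_cases (levelRadius m (Φ i) s) d with h' | h' <;>
    rcases min_cases (levelRadius m (Φ i) t) d with h'' | h'' <;>
    simp only [h.1] at h3 <;> simp only [h'.1, h''.1] <;> linarith
  have hM := sum_pow_mul_add_le hR hρl hρ0 (l + 1 - k) k (by omega) hρa
  have ha : ∑ i ∈ Finset.Ico k (l + 1), R ^ i * a i ≤ 4 * τ := by
    have h1 : ∑ i ∈ Finset.Ico k (l + 1), R ^ i * a i ≤
        ∑ i ∈ Finset.range (l + 1), R ^ i * a i := by
      refine Finset.sum_le_sum_of_subset_of_nonneg (fun i hi => ?_) fun i _ _ => ?_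
      · simp only [Finset.mem_Ico, Finset.mem_range] at hi ⊢
        omega
      · simp only [hadef, mul_add]
        exact add_nonneg (hmin0 i s) (hmin0 i t)
    have h2 := hsum (l + 1) (Or.inl rfl)
    have h3 := hsum (l + 1) (Or.inr rfl)
    simp only [hadef, mul_add, Finset.sum_add_distrib] at h1 ⊢
    linarith
  have hkρ : 0 ≤ R ^ k * ρ k := mul_nonneg (by positivity) (hρ0 k)
  have hsplit : ∑ i ∈ Finset.Ico k (l + 1), R ^ i * ρ i =
      ∑ i ∈ Finset.Ico k l, R ^ i * ρ i + R ^ l * ρ l :=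
    Finset.sum_Ico_succ_top hkl _
  have hlρ : 0 ≤ R ^ l * ρ l := mul_nonneg (by positivity) (hρ0 l)
  have hS0 : 0 ≤ ∑ i ∈ Finset.Ico k l, R ^ i * ρ i :=
    Finset.sum_nonneg fun i _ => mul_nonneg (by positivity) (hρ0 i)
  set S := ∑ i ∈ Finset.Ico k l, R ^ i * ρ i
  have hS : S ≤ 16 * τ := by linarith
  have hkρ' : R ^ k * ρ k ≤ 16 * τ := by linarith
  have hchain : ∀ x, (x = s ∨ x = t) → (∀ u, dist u x < η → |f x - f u| ≤ ε / 2) →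
      ∃ p : T → ℝ≥0∞, Measurable p ∧ ∫⁻ u, p u ∂m = 1 ∧ (∀ u, p u ≤ ENNReal.ofReal (Φ k)) ∧
      (∀ u, p u ≠ 0 → dist u x ≤ ρ k) ∧
      ∫⁻ u, p u * ENNReal.ofReal |f x - f u| ∂m ≤ ENNReal.ofReal (ε / 2) +
        Γ * ENNReal.ofReal (R ^ (n₀ + 1) * S) := by
    intro x hx hfx
    have hb : ∀ i ≤ l, levelRadius m (Φ i) x + 2 * ρ (i + 1) ≤ ρ i := by
      intro i hi
      rw [hρ i hi]
      gcongr
      rcases hx with rfl | rfl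
      · exact le_max_left _ _
      · exact le_max_right _ _
    refine exists_density_lintegral_abs_sub_le hψ hψ1 hR1 n₀ hΦ hf hΓ hρ0 ?_
      (fun i hi => hb i hi.le) (fun u hu => hfx u (hu.trans_lt (hrl x hx))) (l - k) k (by omega)
    linarith [hb l le_rfl]
  obtain ⟨p, hpm, hp1, hpb, hps, hpf⟩ := hchain s (Or.inl rfl) fun u hu => by
    have := hs u (hu.trans_le ((min_le_left _ _).trans (min_le_left _ _)))
    rw [dist_comm, Real.dist_eq] at this
    exact this.le
  obtain ⟨q, hqm, hq1, hqb, hqs, hqf⟩ := hchain t (Or.inr rfl) fun u hu => by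
    have := ht u (hu.trans_le ((min_le_left _ _).trans (min_le_right _ _)))
    rw [dist_comm, Real.dist_eq] at this
    exact this.le
  obtain ⟨j, rfl⟩ : ∃ j, k = j + 1 := ⟨k - 1, by omega⟩
  have hpq := lintegral_mul_abs_sub_le (m := m) hψ hψ1 (A := R ^ (j + 2 + n₀))
    (D := d + 2 * ρ (j + 1)) (c := Φ (j + 2)) (q := fun u v => p u * q v)
    (one_le_pow₀ hR1) hf ((hpm.comp measurable_fst).mul (hqm.comp measurable_snd))
    (measurable_stripWeight m hΦ j)
    (by simp_rw [lintegral_const_mul _ hqm, hq1, mul_one, hp1]; exact le_rfl)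
    (fun u v h => by
      have h1 := hps u (left_ne_zero_of_mul h)
      have h2 := hqs v (right_ne_zero_of_mul h)
      have h3 := dist_triangle4 u s t v
      rw [dist_comm t v] at h3
      linarith)
    (fun u v => by
      by_cases h : p u * q v = 0
      · simp [h]
      have h1 := hps u (left_ne_zero_of_mul h)
      have h2 := hqs v (right_ne_zero_of_mul h)
      have h3 := dist_triangle4 u s t v
      rw [dist_comm t v] at h3
      have hcond : j = 0 ∨ dist u v < levelRadius m (Φ j) u := by
        rcases hPk with hk | hk
        · exact Or.inl (by omega)
        · right
          have h4 := levelRadius_le_add_dist m (hΦ j) s u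
          rw [dist_comm s u] at h4
          simp only [Nat.add_sub_cancel] at hk
          linarith
      rw [stripWeight, if_pos hcond, ← ENNReal.ofReal_mul (zero_le_one.trans (hΦ _))]
      refine (mul_le_mul' (hpb u) (hqb v)).trans ?_
      rw [← ENNReal.ofReal_mul (zero_le_one.trans (hΦ _))]
      refine ENNReal.ofReal_le_ofReal ?_
      have := hlc j
      simp only [hΦdef]
      nlinarith)
  have hdk : R ^ (j + 1) * d ≤ 2 * R * τ := by
    rcases hPk with hk | hk
    · obtain rfl : j = 0 := by omega
      rw [zero_add, pow_one]
      nlinarith [mul_le_mul_of_nonneg_left hdτ hR0.le, mul_pos hR0 hτ0]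
    · simp only [Nat.add_sub_cancel] at hk
      have h1 := hterm j s (Or.inl rfl)
      rw [min_eq_right (by linarith [hρ0 (j + 1)])] at h1
      rw [pow_succ]
      nlinarith
  calc ENNReal.ofReal |f s - f t|
      ≤ _ := ofReal_abs_sub_le_lintegral_add hf s t hpm hqm hp1 hq1
    _ ≤ (ENNReal.ofReal (ε / 2) + Γ * ENNReal.ofReal (R ^ (n₀ + 1) * S)) +
          ENNReal.ofReal ((d + 2 * ρ (j + 1)) * R ^ (j + 2 + n₀)) * Γ +
          (ENNReal.ofReal (ε / 2) + Γ * ENNReal.ofReal (R ^ (n₀ + 1) * S)) := by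
        gcongr
        exact hpq.trans (by gcongr; exact hΓ' j)
    _ = Γ * ENNReal.ofReal (R ^ (n₀ + 1) * S + (d + 2 * ρ (j + 1)) * R ^ (j + 2 + n₀) +
          R ^ (n₀ + 1) * S) + ENNReal.ofReal (ε / 2 + ε / 2) := by
        have := hρ0 (j + 1)
        rw [ENNReal.ofReal_add (by positivity) (by positivity),
          ENNReal.ofReal_add (by positivity) (by positivity),
          ENNReal.ofReal_add (by positivity) (by positivity)]
        ring
    _ ≤ _ := by
        rw [← ENNReal.ofReal_mul hC.le, add_halves, ENNReal.ofReal_coe_nnreal]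
        gcongr
        have hRn : 0 < R ^ (n₀ + 1) := by positivity
        have h1 : (d + 2 * ρ (j + 1)) * R ^ (j + 2 + n₀) =
            R ^ (n₀ + 1) * (R ^ (j + 1) * d + 2 * (R ^ (j + 1) * ρ (j + 1))) := by ring
        rw [h1, ← mul_add, ← mul_add, mul_assoc]
        gcongr
        linarith

end Pathwise

/-! ### Reduction to a large ratio, and the expected energy -/

lemma mul_le_mul_of_sq_le {a : ℕ → ℝ} (ha : ∀ i, 0 < a i)
    (h : ∀ i, a (i + 1) ^ 2 ≤ a i * a (i + 2)) (q : ℕ) {n k : ℕ} (hnk : n ≤ k) :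
    a (n + q) * a k ≤ a n * a (k + q) := by
  have hmono : Monotone fun i => a (i + 1) / a i := monotone_nat_of_le_succ fun i => by
    rw [div_le_div_iff₀ (ha _) (ha _)]
    linarith [h i]
  induction q with
  | zero => simp
  | succ q ih =>
    have h1 := hmono (Nat.add_le_add_right hnk q)
    simp only [div_le_div_iff₀ (ha _) (ha _)] at h1
    refine le_of_mul_le_mul_right ?_ (mul_pos (ha (n + q)) (ha (k + q)))
    calc a (n + (q + 1)) * a k * (a (n + q) * a (k + q))
        = (a (n + q) * a k) * (a (n + q + 1) * a (k + q)) := by ring_nf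
      _ ≤ (a n * a (k + q)) * (a (k + q + 1) * a (n + q)) :=
        mul_le_mul ih h1 (mul_nonneg (ha _).le (ha _).le) (mul_nonneg (ha _).le (ha _).le)
      _ = _ := by ring_nf

section ExpectedEnergy

variable {ψ : ℝ → ℝ} {T Ω : Type*} [MetricSpace T] [CompactSpace T] [MeasurableSpace T]
  [BorelSpace T] {m : Measure T} [IsProbabilityMeasure m] [MeasurableSpace Ω] {P : Measure Ω}
  {X : Ω → T → ℝ} {w : T → T → ℝ≥0∞}

lemma measurable_young_increment_process (hψ : IsYoungFunction ψ)
    (hX : ∀ t, Measurable fun ω => X ω t) (hXc : ∀ ω, Continuous (X ω)) :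
    Measurable fun z : Ω × (T × T) =>
      ENNReal.ofReal (ψ (|X z.1 z.2.1 - X z.1 z.2.2| / dist z.2.1 z.2.2)) := by
  have := secondCountable_of_compactSpace T
  have hjoint : Measurable fun z : T × Ω => X z.2 z.1 :=
    measurable_uncurry_of_continuous_of_measurable (u := fun t ω => X ω t) hXc hX
  have h1 : Measurable fun z : Ω × (T × T) => X z.1 z.2.1 :=
    hjoint.comp (measurable_snd.fst.prodMk measurable_fst)
  have h2 : Measurable fun z : Ω × (T × T) => X z.1 z.2.2 :=
    hjoint.comp (measurable_snd.snd.prodMk measurable_fst)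
  exact (hψ.measurable_comp ((measurable_norm.comp (h1.sub h2)).div
    (continuous_dist.measurable.comp measurable_snd)) fun z =>
      div_nonneg (abs_nonneg _) dist_nonneg).ennreal_ofReal

lemma energy_eq_lintegral_prod (hψ : IsYoungFunction ψ)
    (hw : Measurable fun p : T × T => w p.1 p.2) {f : T → ℝ} (hf : Continuous f) :
    energy m ψ w f =
      ∫⁻ p, w p.1 p.2 * ENNReal.ofReal (ψ (|f p.1 - f p.2| / dist p.1 p.2)) ∂m.prod m :=
  (lintegral_prod _ (hw.mul (measurable_young_increment hψ hf)).aemeasurable).symm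

lemma measurable_energy_process (hψ : IsYoungFunction ψ)
    (hX : ∀ t, Measurable fun ω => X ω t) (hXc : ∀ ω, Continuous (X ω))
    (hw : Measurable fun p : T × T => w p.1 p.2) :
    Measurable fun ω => energy m ψ w (X ω) := by
  simp_rw [fun ω => energy_eq_lintegral_prod (m := m) hψ hw (hXc ω)]
  exact ((hw.comp measurable_snd).mul
    (measurable_young_increment_process hψ hX hXc)).lintegral_prod_right'

lemma lintegral_energy_process_le [SFinite P] (hψ : IsYoungFunction ψ)
    (hX : ∀ t, Measurable fun ω => X ω t) (hXc : ∀ ω, Continuous (X ω))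
    (hXψ : ∀ s t, s ≠ t → ∫⁻ ω, ENNReal.ofReal (ψ (|X ω s - X ω t| / dist s t)) ∂P ≤ 1)
    (hw : Measurable fun p : T × T => w p.1 p.2) (hw1 : ∀ u, ∫⁻ v, w u v ∂m ≤ 1) :
    ∫⁻ ω, energy m ψ w (X ω) ∂P ≤ 1 := by
  have hmeas := measurable_young_increment_process (Ω := Ω) hψ hX hXc
  calc ∫⁻ ω, energy m ψ w (X ω) ∂P
      = ∫⁻ p, ∫⁻ ω, w p.1 p.2 *
          ENNReal.ofReal (ψ (|X ω p.1 - X ω p.2| / dist p.1 p.2)) ∂P ∂m.prod m := by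
        simp_rw [fun ω => energy_eq_lintegral_prod (m := m) hψ hw (hXc ω)]
        exact lintegral_lintegral_swap ((hw.comp measurable_snd).mul hmeas).aemeasurable
    _ ≤ ∫⁻ p, w p.1 p.2 ∂m.prod m := by
        refine lintegral_mono fun p => ?_
        have hp : Measurable fun ω =>
            ENNReal.ofReal (ψ (|X ω p.1 - X ω p.2| / dist p.1 p.2)) :=
          hmeas.comp (measurable_prodMk_right (y := p))
        rw [lintegral_const_mul _ hp]
        refine mul_le_of_le_one_right' ?_
        by_cases hp : p.1 = p.2
        · simp [hp, hψ.2.2.1]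
        · exact hXψ _ _ hp
    _ = ∫⁻ u, ∫⁻ v, w u v ∂m ∂m := lintegral_prod _ hw.aemeasurable
    _ ≤ ∫⁻ _, 1 ∂m := lintegral_mono hw1
    _ = 1 := by simp

lemma lintegral_tsum_mul_energy_process_le [SFinite P] (hψ : IsYoungFunction ψ)
    (hX : ∀ t, Measurable fun ω => X ω t) (hXc : ∀ ω, Continuous (X ω))
    (hXψ : ∀ s t, s ≠ t → ∫⁻ ω, ENNReal.ofReal (ψ (|X ω s - X ω t| / dist s t)) ∂P ≤ 1)
    {w : ℕ → T → T → ℝ≥0∞} (hw : ∀ j, Measurable fun p : T × T => w j p.1 p.2)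
    (hw1 : ∀ j u, ∫⁻ v, w j u v ∂m ≤ 1) (c : ℕ → ℝ≥0∞) :
    ∫⁻ ω, ∑' j, c j * energy m ψ (w j) (X ω) ∂P ≤ ∑' j, c j := by
  rw [lintegral_tsum fun j =>
    ((measurable_energy_process hψ hX hXc (hw j)).const_mul (c j)).aemeasurable]
  refine ENNReal.tsum_le_tsum fun j => ?_
  rw [lintegral_const_mul _ (measurable_energy_process hψ hX hXc (hw j))]
  exact mul_le_of_le_one_right' (lintegral_energy_process_le hψ hX hXc hXψ (hw j) (hw1 j))

end ExpectedEnergy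

/-- The case of a large ratio `R`, with an explicit constant. -/
theorem lintegral_iSup_abs_sub_div_tauDist_le {φ ψ : ℝ → ℝ} (hφ : IsYoungFunction φ)
    (hψ : IsYoungFunction ψ) (hφ1 : φ 1 = 1) (hψ1 : ψ 1 = 1) {R : ℝ} (hR : 10 ≤ R) (n₀ : ℕ)
    (hlc : ∀ k : ℕ, φ (R ^ (k + 1)) ^ 2 ≤ φ (R ^ k) * φ (R ^ (k + 2)))
    (hsum : Summable fun k : ℕ => φ (R ^ k) / ψ (R ^ (k + n₀)))
    {T Ω : Type*} [MetricSpace T] [CompactSpace T] [MeasurableSpace T] [BorelSpace T]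
    (m : Measure T) [IsProbabilityMeasure m] [MeasurableSpace Ω] (P : Measure Ω)
    [IsProbabilityMeasure P] {X : Ω → T → ℝ} (hX : ∀ t, Measurable fun ω => X ω t)
    (hXc : ∀ ω, Continuous (X ω))
    (hXψ : ∀ s t, s ≠ t → ∫⁻ ω, ENNReal.ofReal (ψ (|X ω s - X ω t| / dist s t)) ∂P ≤ 1) :
    ∫⁻ ω, ⨆ s, ⨆ t, ⨆ (_ : s ≠ t), ENNReal.ofReal |X ω s - X ω t| /
      (ENNReal.ofReal (R ^ (n₀ + 1) * (64 + 2 * R) *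
        (1 + 2 * ∑' k, φ (R ^ k) / ψ (R ^ (k + n₀)))) * tauDist m φ s t) ∂P ≤ 1 := by
  have hR1 : 1 ≤ R := by linarith
  have hΦ : ∀ k : ℕ, 1 ≤ φ (R ^ k) := fun k => hφ.one_le_map hφ1 (one_le_pow₀ hR1)
  have hΨ : ∀ k : ℕ, 1 ≤ ψ (R ^ k) := fun k => hψ.one_le_map hψ1 (one_le_pow₀ hR1)
  set c : ℕ → ℝ := fun k => φ (R ^ k) / ψ (R ^ (k + n₀))
  have hc0 : ∀ k, 0 ≤ c k := fun k =>
    div_nonneg (zero_le_one.trans (hΦ k)) (zero_le_one.trans (hΨ _))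
  set S := ∑' k, c k
  have hS0 : 0 ≤ S := tsum_nonneg hc0
  have htail : ∀ i, ∑' j, ENNReal.ofReal (c (j + i)) ≤ ENNReal.ofReal S := fun i => by
    rw [ENNReal.ofReal_tsum_of_nonneg hc0 hsum]
    exact ENNReal.tsum_comp_le_tsum_of_injective (add_left_injective i) _
  set E₁ : Ω → ℝ≥0∞ := fun ω =>
    ∑' j, ENNReal.ofReal (c (j + 1)) * energy m ψ (ballWeight m (φ (R ^ j))) (X ω)
  set E₂ : Ω → ℝ≥0∞ := fun ω =>
    ∑' j, ENNReal.ofReal (c (j + 2)) * energy m ψ (stripWeight m (fun k => φ (R ^ k)) j) (X ω)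
  have hmeas₁ : Measurable E₁ := Measurable.tsum fun j =>
    (measurable_energy_process hψ hX hXc (measurable_ballWeight m (hΦ j))).const_mul _
  have hI₁ : ∫⁻ ω, E₁ ω ∂P ≤ ENNReal.ofReal S :=
    (lintegral_tsum_mul_energy_process_le hψ hX hXc hXψ (fun j => measurable_ballWeight m (hΦ j))
      (fun j u => (lintegral_ballWeight m (hΦ j) u).le) _).trans (htail 1)
  have hI₂ : ∫⁻ ω, E₂ ω ∂P ≤ ENNReal.ofReal S :=
    (lintegral_tsum_mul_energy_process_le hψ hX hXc hXψ (fun j => measurable_stripWeight m hΦ j)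
      (fun j u => lintegral_stripWeight_le m (by simpa using hφ1) j u) _).trans (htail 2)
  have hD : ENNReal.ofReal (1 + 2 * S) = 1 + ENNReal.ofReal S + ENNReal.ofReal S := by
    rw [← ENNReal.ofReal_one, ← ENNReal.ofReal_add zero_le_one hS0,
      ← ENNReal.ofReal_add (by positivity) hS0]
    ring_nf
  have hD0 : ENNReal.ofReal (1 + 2 * S) ≠ 0 := by
    rw [ne_eq, ENNReal.ofReal_eq_zero, not_le]
    positivity
  calc _ ≤ ∫⁻ ω, (1 + E₁ ω + E₂ ω) * (ENNReal.ofReal (1 + 2 * S))⁻¹ ∂P := by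
        refine lintegral_mono fun ω => iSup_le fun s => iSup_le fun t => iSup_le fun _ => ?_
        refine ENNReal.div_le_of_le_mul ?_
        have h := ofReal_abs_sub_le_mul_tauDist (m := m) hφ hψ hφ1 hψ1 hR n₀ hlc (hXc ω)
          (Γ := 1 + E₁ ω + E₂ ω)
          (fun j => (add_le_add_right (ENNReal.le_tsum (f := fun j => ENNReal.ofReal (c (j + 1)) *
            energy m ψ (ballWeight m (φ (R ^ j))) (X ω)) j) 1).trans le_self_add)
          (fun j => add_le_add le_self_add (ENNReal.le_tsum (f := fun j =>
            ENNReal.ofReal (c (j + 2)) *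
              energy m ψ (stripWeight m (fun k => φ (R ^ k)) j) (X ω)) j)) s t
        refine h.trans (le_of_eq ?_)
        rw [ENNReal.ofReal_mul (q := 1 + 2 * S) (by positivity)]
        calc _ = (1 + E₁ ω + E₂ ω) *
              ((ENNReal.ofReal (1 + 2 * S))⁻¹ * ENNReal.ofReal (1 + 2 * S)) *
              (ENNReal.ofReal (R ^ (n₀ + 1) * (64 + 2 * R)) * tauDist m φ s t) := by
              rw [ENNReal.inv_mul_cancel hD0 ENNReal.ofReal_ne_top, mul_one]
          _ = _ := by ring
    _ = (1 + ∫⁻ ω, E₁ ω ∂P + ∫⁻ ω, E₂ ω ∂P) * (ENNReal.ofReal (1 + 2 * S))⁻¹ := by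
        rw [lintegral_mul_const' _ _ (ENNReal.inv_ne_top.2 hD0),
          lintegral_add_left (hmeas₁.const_add 1), lintegral_add_right _ hmeas₁]
        simp
    _ ≤ ENNReal.ofReal (1 + 2 * S) * (ENNReal.ofReal (1 + 2 * S))⁻¹ := by
        gcongr
        rw [hD]
        gcongr
    _ = 1 := ENNReal.mul_inv_cancel hD0 ENNReal.ofReal_ne_top

/-- first part of Corollary 1 of the paper. -/
theorem statement2 (φ ψ : ℝ → ℝ) (hφ : IsYoungFunction φ) (hψ : IsYoungFunction ψ)
    (hφ1 : φ 1 = 1) (hψ1 : ψ 1 = 1) (R : ℝ) (hR : 1 < R) (n₀ : ℕ) (hn₀ : 1 ≤ n₀)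
    (hmiau : ∀ k : ℕ, 1 ≤ k → φ (R ^ k) / φ (R ^ (k + 1)) ≤ φ (R ^ (k - 1)) / φ (R ^ k))
    (hpap : Summable fun k : ℕ => φ (R ^ k) / ψ (R ^ (k + n₀))) :
    ∃ K : ℝ, 0 < K ∧
      ∀ (T : Type) [MetricSpace T] [CompactSpace T] [MeasurableSpace T] [BorelSpace T]
        (m : Measure T), IsProbabilityMeasure m →
          ∀ (Ω : Type) [MeasurableSpace Ω] (P : Measure Ω), IsProbabilityMeasure P →
            ∀ X : Ω → T → ℝ,
              (∀ t : T, Measurable fun ω => X ω t) →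
              (∀ ω : Ω, Continuous (X ω)) →
              (∀ s t : T, s ≠ t →
                ∫⁻ ω, ENNReal.ofReal (ψ (|X ω s - X ω t| / dist s t)) ∂P ≤ 1) →
              ∫⁻ ω, ⨆ s, ⨆ t, ⨆ (_ : s ≠ t),
                  ENNReal.ofReal |X ω s - X ω t| /
                    (ENNReal.ofReal (2 * K) * tauDist m φ s t) ∂P ≤ 1 := by
  have hR0 : 0 ≤ R := zero_le_one.trans hR.le
  have hφR : ∀ k : ℕ, 1 ≤ φ (R ^ k) := fun k => hφ.one_le_map hφ1 (one_le_pow₀ hR.le)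
  have hψR : ∀ k : ℕ, 1 ≤ ψ (R ^ k) := fun k => hψ.one_le_map hψ1 (one_le_pow₀ hR.le)
  have hφ0 : ∀ k : ℕ, 0 < φ (R ^ k) := fun k => zero_lt_one.trans_le (hφR k)
  have hψ0 : ∀ k : ℕ, 0 < ψ (R ^ k) := fun k => zero_lt_one.trans_le (hψR k)
  have hlc : ∀ k : ℕ, φ (R ^ (k + 1)) ^ 2 ≤ φ (R ^ k) * φ (R ^ (k + 2)) := fun k => by
    have h := hmiau (k + 1) (by omega)
    rw [div_le_div_iff₀ (hφ0 _) (hφ0 _), Nat.add_sub_cancel] at h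
    linarith
  obtain ⟨q, hq, hq1⟩ := (((tendsto_pow_atTop_atTop_of_one_lt hR).eventually_ge_atTop 10).and
    (eventually_ge_atTop 1)).exists
  have hlcq : ∀ k : ℕ,
      φ ((R ^ q) ^ (k + 1)) ^ 2 ≤ φ ((R ^ q) ^ k) * φ ((R ^ q) ^ (k + 2)) := fun k => by
    have h := mul_le_mul_of_sq_le hφ0 hlc q (Nat.le_add_right (q * k) q)
    rw [← pow_mul, ← pow_mul, ← pow_mul, sq, mul_add_one,
      show q * (k + 2) = q * k + q + q by ring]
    exact h
  have hsum : Summable fun k : ℕ => φ ((R ^ q) ^ k) / ψ ((R ^ q) ^ (k + n₀)) := by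
    refine Summable.of_nonneg_of_le (fun k => ?_) (fun k => ?_)
      (hpap.comp_injective (mul_right_injective₀ (by omega : q ≠ 0)))
    · rw [← pow_mul, ← pow_mul]
      exact div_nonneg (hφ0 _).le (hψ0 _).le
    · rw [← pow_mul, ← pow_mul]
      refine div_le_div_of_nonneg_left (hφ0 _).le (hψ0 _) (hψ.1 (Set.mem_Ici.2 (by positivity))
        (Set.mem_Ici.2 (by positivity)) (pow_le_pow_right₀ hR.le ?_))
      rw [mul_add]
      exact Nat.add_le_add_left (Nat.le_mul_of_pos_left _ hq1) _
  have hS : 0 ≤ ∑' k, φ ((R ^ q) ^ k) / ψ ((R ^ q) ^ (k + n₀)) := tsum_nonneg fun k => by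
    rw [← pow_mul, ← pow_mul]
    exact div_nonneg (hφ0 _).le (hψ0 _).le
  refine ⟨(R ^ q) ^ (n₀ + 1) * (64 + 2 * R ^ q) *
    (1 + 2 * ∑' k, φ ((R ^ q) ^ k) / ψ ((R ^ q) ^ (k + n₀))) / 2, by positivity, ?_⟩
  intro T _ _ _ _ m _ Ω _ P _ X hX hXc hXψ
  rw [mul_div_cancel₀ _ two_ne_zero]
  exact lintegral_iSup_abs_sub_div_tauDist_le hφ hψ hφ1 hψ1 hq n₀ hlcq hsum m P hX hXc hXψ
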